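/- For every ε > 0 there is a constant c_ε > 0 such that for every N ∈ ℕ, N ≥ 1: if f ∈ L¹(ℝ) has ∫ f ≠ 0 and tiles with each of the lattices Λ_j = (N/(N+j))·ℤ, j = 1, …, N, then diam(supp f) ≥ c_ε · N^{1−ε}. -/

import Mathlib

open MeasureTheory

noncomputable section

/-- The essential support of `f`: the smallest closed set outside of which `f` vanishes a.e. -/
def essSupp {α E : Type*} [TopologicalSpace α] [MeasureSpace α] [Zero E]
    (f : α → E) : Set α :=
  ⋂₀ {S : Set α | IsClosed S ∧ ∀ᵐ x, x ∉ S → f x = 0}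

/-- `f : ℝ → ℂ` tiles with the one–dimensional lattice `λ·ℤ` at level `c`. -/
def TilesAt1 (f : ℝ → ℂ) (lam : ℝ) (c : ℂ) : Prop :=
  ∀ᵐ x : ℝ, (Summable fun n : ℤ => f (x - n * lam)) ∧ ∑' n : ℤ, f (x - n * lam) = c

theorem zero_bound (R : ℝ) (hR : 0 < R) (s : Finset ℂ) : ∀ (F : ℂ → ℂ) (M : ℝ),
    Differentiable ℂ F → (∀ z ∈ Metric.sphere (0:ℂ) R, ‖F z‖ ≤ M) →
    (∀ z ∈ s, ‖z‖ ≤ R / 4 ∧ F z = 0) → ‖F 0‖ * 3 ^ s.card ≤ M := by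
  classical
  induction s using Finset.induction_on with
  | empty =>
    intro F M hF hM _
    simp only [Finset.card_empty, pow_zero, mul_one]
    refine Complex.norm_le_of_forall_mem_frontier_norm_le (Metric.isBounded_ball (x := (0:ℂ)) (r := R))
      hF.diffContOnCl ?_ (subset_closure (Metric.mem_ball_self hR))
    intro z hz
    rw [frontier_ball _ hR.ne'] at hz
    exact hM z hz
  | insert w s hw ih =>
    intro F M hF hM hs
    obtain ⟨hwR, hFw⟩ := hs w (Finset.mem_insert_self _ _)
    have key : ∀ z, F z = (z - w) * dslope F w z := by
      intro z
      have := sub_smul_dslope F w z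
      rw [hFw, sub_zero, smul_eq_mul] at this
      exact this.symm
    have hG : Differentiable ℂ (dslope F w) := by
      have := (Complex.differentiableOn_dslope (f := F) (s := Set.univ) (c := w) Filter.univ_mem).2
        hF.differentiableOn
      exact differentiableOn_univ.1 this
    have hGM : ∀ z ∈ Metric.sphere (0:ℂ) R, ‖dslope F w z‖ ≤ M / (3 * R / 4) := by
      intro z hz
      have h1 := hM z hz
      rw [key z, norm_mul] at h1
      have hz' : ‖z‖ = R := by simpa using hz
      have h2 : 3 * R / 4 ≤ ‖z - w‖ := by
        have := norm_sub_norm_le z w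
        linarith
      rw [le_div_iff₀ (by positivity), mul_comm]
      exact (mul_le_mul_of_nonneg_right h2 (norm_nonneg _)).trans h1
    have hGs : ∀ z ∈ s, ‖z‖ ≤ R / 4 ∧ dslope F w z = 0 := by
      intro z hz
      obtain ⟨h1, h2⟩ := hs z (Finset.mem_insert_of_mem hz)
      refine ⟨h1, ?_⟩
      rw [key z] at h2
      rcases mul_eq_zero.1 h2 with h | h
      · exact absurd (sub_eq_zero.1 h ▸ hz) hw
      · exact h
    have h := ih _ _ hG hGM hGs
    rw [le_div_iff₀ (by positivity)] at h
    rw [Finset.card_insert_of_notMem hw, key 0, zero_sub, norm_mul, norm_neg, pow_succ]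
    have h0 : 0 ≤ ‖dslope F w 0‖ * 3 ^ s.card := by positivity
    nlinarith

theorem transform_zero (f : ℝ → ℂ) (hf : Integrable f) (lam : ℝ) (hl : 0 < lam) (c : ℂ)
    (ht : TilesAt1 f lam c) (k : ℕ) (hk : k ≠ 0) (ξ : ℝ) (hξ : ξ * lam = k) :
    ∫ x, f x * Complex.exp (-2 * Real.pi * Complex.I * ξ * x) = 0 := by
  set e : ℝ → ℂ := fun x => Complex.exp (-2 * Real.pi * Complex.I * ξ * x) with he
  have hper : ∀ (x : ℝ) (n : ℤ), e (x - n * lam) = e x := by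
    intro x n
    have : (ξ : ℂ) * lam = k := by exact_mod_cast hξ
    simp only [he]
    rw [Complex.exp_eq_exp_iff_exists_int]
    refine ⟨n * k, ?_⟩
    push_cast
    rw [← this]; ring
  have hec : Continuous e := by fun_prop
  have hen : ∀ x, ‖e x‖ = 1 := by
    intro x
    simp only [he]
    rw [Complex.norm_exp]
    simp
  have hfe : Integrable (fun x => f x * e x) := by
    refine hf.mul_bdd (c := 1) hec.aestronglyMeasurable ?_
    exact Filter.Eventually.of_forall fun x => (hen x).le
  have hD := isAddFundamentalDomain_Ioc hl 0
  let φ : ℤ ≃ AddSubgroup.zmultiples lam :=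
    (Equiv.ofInjective (fun n : ℤ => n • lam) (zsmul_left_strictMono hl).injective)
  have hφ : ∀ n, ((φ n : AddSubgroup.zmultiples lam) : ℝ) = n * lam := by
    intro n
    change n • lam = n * lam
    exact zsmul_eq_mul _ _
  have h1 := hD.integral_eq_tsum' _ hfe
  rw [← φ.tsum_eq] at h1
  have hv : ∀ (n : ℤ) (x : ℝ), (-(φ n)) +ᵥ x = x - n * lam := by
    intro n x
    rw [AddSubgroup.vadd_def, AddSubgroup.coe_neg, hφ, vadd_eq_add]; ring
  simp only [hv] at h1
  have h2 := hD.lintegral_eq_tsum' (fun x => ‖f x * e x‖ₑ)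
  rw [← φ.tsum_eq] at h2
  simp only [hv] at h2
  rw [h1, ← integral_tsum]
  · have : ∀ᵐ x : ℝ ∂(volume.restrict (Set.Ioc 0 (0 + lam))),
        ∑' n : ℤ, f (x - n * lam) * e (x - n * lam) = c * e x := by
      refine ae_restrict_of_ae ?_
      filter_upwards [ht] with x hx
      simp only [hper]
      rw [tsum_mul_right, hx.2]
    rw [integral_congr_ae this, integral_const_mul, ← intervalIntegral.integral_of_le (by linarith)]
    have hξ0 : ξ ≠ 0 := by
      rintro rfl
      rw [zero_mul] at hξ
      exact hk (by exact_mod_cast hξ.symm)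
    have hne : (-2 * Real.pi * Complex.I * ξ : ℂ) ≠ 0 := by
      simp [Real.pi_ne_zero, hξ0]
    have := integral_exp_mul_complex (a := 0) (b := 0 + lam) hne
    simp only [he]
    rw [this]
    have h3 := hper lam 1
    simp only [he] at h3
    rw [zero_add, ← h3]
    simp
  · intro n
    have : AEStronglyMeasurable (fun x => f (x - n * lam) * e (x - n * lam)) volume :=
      (hfe.comp_sub_right (n * lam)).aestronglyMeasurable
    exact this.restrict
  · rw [← h2]
    exact hfe.2.ne

theorem ae_essSupp (f : ℝ → ℂ) : ∀ᵐ x, x ∉ essSupp f → f x = 0 := by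
  obtain ⟨T, hTc, hTS, hT⟩ := TopologicalSpace.isOpen_sUnion_countable
    (compl '' {S : Set ℝ | IsClosed S ∧ ∀ᵐ x, x ∉ S → f x = 0})
    (by rintro _ ⟨S, hS, rfl⟩; exact hS.1.isOpen_compl)
  have h : ∀ᵐ x : ℝ, ∀ U ∈ T, x ∈ U → f x = 0 := by
    rw [ae_ball_iff hTc]
    intro U hU
    obtain ⟨S, hS, rfl⟩ := hTS hU
    exact hS.2
  filter_upwards [h] with x hx hxs
  rw [← Set.mem_compl_iff, essSupp, Set.compl_sInter, ← hT] at hxs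
  obtain ⟨U, hU, hxU⟩ := hxs
  exact hx U hU hxU

theorem transform_diff (f : ℝ → ℂ) (hf : Integrable f) (a D : ℝ) (hD : 0 ≤ D)
    (hs : ∀ᵐ x, f x ≠ 0 → |x - a| ≤ D) :
    Differentiable ℂ (fun z : ℂ => ∫ x, f x * Complex.exp (-2 * Real.pi * Complex.I * z * (x - a))) ∧
    ∀ z : ℂ, ‖∫ x, f x * Complex.exp (-2 * Real.pi * Complex.I * z * (x - a))‖ ≤
      (∫ x, ‖f x‖) * Real.exp (2 * Real.pi * D * ‖z‖) := by
  have hE : ∀ (z : ℂ) (x : ℝ), |x - a| ≤ D →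
      ‖Complex.exp (-2 * Real.pi * Complex.I * z * (x - a))‖ ≤ Real.exp (2 * Real.pi * D * ‖z‖) := by
    intro z x hx
    refine (Complex.norm_exp_le_exp_norm _).trans (Real.exp_le_exp.2 ?_)
    have : ‖(-2 * Real.pi * Complex.I * z * (x - a) : ℂ)‖ = 2 * Real.pi * |x - a| * ‖z‖ := by
      rw [norm_mul, norm_mul, norm_mul, norm_mul, ← Complex.ofReal_sub, Complex.norm_real, Complex.norm_real]
      simp [abs_of_pos Real.pi_pos]
      ring
    rw [this]
    have := Real.pi_pos
    gcongr
  have hB : ∀ z : ℂ, ∀ᵐ x : ℝ, ‖f x * Complex.exp (-2 * Real.pi * Complex.I * z * (x - a))‖ ≤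
      ‖f x‖ * Real.exp (2 * Real.pi * D * ‖z‖) := by
    intro z
    filter_upwards [hs] with x hx
    by_cases h : f x = 0
    · simp [h]
    · rw [norm_mul]
      gcongr
      exact hE z x (hx h)
  have hm : ∀ z : ℂ, AEStronglyMeasurable
      (fun x : ℝ => f x * Complex.exp (-2 * Real.pi * Complex.I * z * (x - a))) volume := by
    intro z
    refine hf.aestronglyMeasurable.mul (Continuous.aestronglyMeasurable ?_)
    fun_prop
  have hI : ∀ z : ℂ, Integrable
      (fun x : ℝ => f x * Complex.exp (-2 * Real.pi * Complex.I * z * (x - a))) volume := by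
    intro z
    exact (hf.norm.mul_const _).mono' (hm z) (hB z)
  constructor
  · intro z₀
    have := hasDerivAt_integral_of_dominated_loc_of_deriv_le (μ := (volume : Measure ℝ))
      (F := fun (z : ℂ) (x : ℝ) => f x * Complex.exp (-2 * Real.pi * Complex.I * z * (x - a)))
      (F' := fun (z : ℂ) (x : ℝ) => f x * Complex.exp (-2 * Real.pi * Complex.I * z * (x - a))
        * (-2 * Real.pi * Complex.I * (x - a)))
      (x₀ := z₀) (s := Metric.ball z₀ 1)
      (bound := fun x => ‖f x‖ * Real.exp (2 * Real.pi * D * (‖z₀‖ + 1)) * (2 * Real.pi * D))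
      (Metric.ball_mem_nhds _ one_pos)
      (Filter.Eventually.of_forall hm) (hI z₀)
      ((hm z₀).mul (Continuous.aestronglyMeasurable (by fun_prop)))
      ?_ ((hf.norm.mul_const _).mul_const _) ?_
    · exact this.2.differentiableAt
    · filter_upwards [hs] with x hx z hz
      by_cases h : f x = 0
      · simp [h]
      · rw [norm_mul, norm_mul]
        have h1 := hE z x (hx h)
        have h2 : ‖z‖ ≤ ‖z₀‖ + 1 := by
          have := norm_le_norm_add_norm_sub' z z₀
          rw [Metric.mem_ball, dist_eq_norm] at hz
          linarith
        have h3 : ‖(-2 * Real.pi * Complex.I * (x - a) : ℂ)‖ = 2 * Real.pi * |x - a| := by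
          rw [norm_mul, norm_mul, norm_mul, ← Complex.ofReal_sub, Complex.norm_real, Complex.norm_real]
          simp [abs_of_pos Real.pi_pos]
        have h4 := Real.pi_pos
        rw [h3]
        have h5 := hx h
        refine mul_le_mul (mul_le_mul_of_nonneg_left (h1.trans (Real.exp_le_exp.2 ?_)) (norm_nonneg _)) ?_
          (by positivity) (by positivity)
        · gcongr
        · gcongr
    · refine Filter.Eventually.of_forall fun x z _ => ?_
      have h1 : HasDerivAt (fun z : ℂ => -2 * Real.pi * Complex.I * z * (x - a))
          (-2 * Real.pi * Complex.I * (x - a)) z := by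
        have := ((hasDerivAt_id z).const_mul (-2 * Real.pi * Complex.I)).mul_const ((x:ℂ) - a)
        simpa using this
      have := (h1.cexp).const_mul (f x)
      simpa [mul_assoc] using this
  · intro z
    rw [← integral_mul_const]
    exact norm_integral_le_of_norm_le (hf.norm.mul_const _) (hB z)

theorem gcd_sum (N : ℕ) (hN : 1 ≤ N) :
    ∑ n ∈ Finset.Ioc N (2 * N), ∑ m ∈ Finset.Ioc N (2 * N), ((Nat.gcd n m : ℕ) : ℝ) ≤
      9 * (N : ℝ) ^ 2 * (1 + Real.log (2 * N)) := by
  set I := Finset.Ioc N (2 * N) with hI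
  set c : ℕ → ℝ := fun d => ∑ n ∈ I, if d ∣ n then (1:ℝ) else 0 with hc
  have h1 : ∀ n ∈ I, ∀ m ∈ I, ((Nat.gcd n m : ℕ) : ℝ) ≤
      ∑ d ∈ Finset.Icc 1 (2 * N), (d : ℝ) * ((if d ∣ n then 1 else 0) * (if d ∣ m then 1 else 0)) := by
    intro n hn m hm
    rw [hI, Finset.mem_Ioc] at hn hm
    have hg : Nat.gcd n m ∈ Finset.Icc 1 (2 * N) := by
      rw [Finset.mem_Icc]
      exact ⟨Nat.gcd_pos_of_pos_left _ (by omega), (Nat.gcd_le_left _ (by omega)).trans hn.2⟩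
    refine le_trans ?_ (Finset.single_le_sum (f := fun d : ℕ => (d : ℝ) * ((if d ∣ n then 1 else 0) * (if d ∣ m then 1 else 0))) ?_ hg)
    · simp [Nat.gcd_dvd_left, Nat.gcd_dvd_right]
    · intro d _
      positivity
  have hcb : ∀ d ∈ Finset.Icc 1 (2 * N), c d ≤ 3 * N / d := by
    intro d hd
    rw [Finset.mem_Icc] at hd
    have hd0 : (0:ℝ) < d := by exact_mod_cast hd.1
    have h2 : c d = ((I.filter (fun n => d ∣ n)).card : ℝ) := by
      simp [hc, Finset.sum_boole]
    have h3 : (I.filter (fun n => d ∣ n)).card + N / d = 2 * N / d := by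
      rw [← Nat.Ioc_filter_dvd_card_eq_div N d, ← Nat.Ioc_filter_dvd_card_eq_div (2 * N) d,
        ← Finset.card_union_of_disjoint]
      · congr 1
        ext x
        simp only [hI, Finset.mem_union, Finset.mem_filter, Finset.mem_Ioc]
        omega
      · rw [Finset.disjoint_left]
        intro x
        simp only [hI, Finset.mem_filter, Finset.mem_Ioc]
        omega
    have h4 : ((I.filter (fun n => d ∣ n)).card : ℝ) + (N / d : ℕ) = (2 * N / d : ℕ) := by
      exact_mod_cast h3
    have h5 : ((2 * N / d : ℕ) : ℝ) ≤ 2 * N / d := by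
      have := Nat.cast_div_le (α := ℝ) (m := 2 * N) (n := d)
      push_cast at this
      exact this
    have h6 : (N : ℝ) / d ≤ (N / d : ℕ) + 1 := (by
      rw [div_le_iff₀ hd0]
      have := Nat.lt_div_mul_add (a := N) (b := d) (by omega)
      have h7 : (N : ℝ) < (N / d : ℕ) * d + d := by exact_mod_cast this
      linarith)
    have h8 : (1:ℝ) ≤ 2 * N / d := by
      rw [le_div_iff₀ hd0]
      have : (d : ℝ) ≤ 2 * N := by exact_mod_cast hd.2
      linarith
    rw [h2]
    have e1 : (2 * N / d : ℝ) = 2 * (N / d) := by ring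
    have e2 : (3 * N / d : ℝ) = 3 * (N / d) := by ring
    linarith
  have hc0 : ∀ d, 0 ≤ c d := fun d => Finset.sum_nonneg fun n _ => by positivity
  calc ∑ n ∈ I, ∑ m ∈ I, ((Nat.gcd n m : ℕ) : ℝ)
      ≤ ∑ n ∈ I, ∑ m ∈ I, ∑ d ∈ Finset.Icc 1 (2 * N),
          (d : ℝ) * ((if d ∣ n then 1 else 0) * (if d ∣ m then 1 else 0)) :=
        Finset.sum_le_sum fun n hn => Finset.sum_le_sum fun m hm => h1 n hn m hm
    _ = ∑ d ∈ Finset.Icc 1 (2 * N), (d : ℝ) * (c d * c d) := by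
        have : ∀ n ∈ I, ∑ m ∈ I, ∑ d ∈ Finset.Icc 1 (2 * N),
          (d : ℝ) * ((if d ∣ n then 1 else 0) * (if d ∣ m then 1 else 0)) =
          ∑ d ∈ Finset.Icc 1 (2 * N), (d : ℝ) * ((if d ∣ n then 1 else 0) * c d) := by
          intro n _
          rw [Finset.sum_comm]
          refine Finset.sum_congr rfl fun d _ => ?_
          simp only [hc, Finset.mul_sum]
        rw [Finset.sum_congr rfl this, Finset.sum_comm]
        refine Finset.sum_congr rfl fun d _ => ?_
        rw [← Finset.mul_sum, ← Finset.sum_mul]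
    _ ≤ ∑ d ∈ Finset.Icc 1 (2 * N), 9 * (N : ℝ) ^ 2 * (d : ℝ)⁻¹ := by
        refine Finset.sum_le_sum fun d hd => ?_
        have h := hcb d hd
        rw [Finset.mem_Icc] at hd
        have hd0 : (0:ℝ) < d := by exact_mod_cast hd.1
        calc (d : ℝ) * (c d * c d) ≤ d * ((3 * N / d) * (3 * N / d)) := by
              have := hc0 d
              gcongr
          _ = _ := by field_simp; ring
    _ ≤ _ := by
        rw [← Finset.mul_sum]
        have := harmonic_le_one_add_log (2 * N)
        rw [harmonic_eq_sum_Icc] at this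
        push_cast at this
        gcongr

theorem count_bound (N : ℕ) (hN : 1 ≤ N) (M : ℕ) :
    ∃ S : Finset ℕ, (∀ m ∈ S, (0 < m ∧ m ≤ M * (2 * N).factorial ^ 2) ∧
        ∃ n ∈ Finset.Ioc N (2 * N), n ∣ m) ∧
      ((M * (2 * N).factorial ^ 2 : ℕ) : ℝ) ≤ 36 * (1 + Real.log (2 * N)) * S.card := by
  classical
  set X := M * (2 * N).factorial ^ 2 with hX
  set I := Finset.Ioc N (2 * N) with hI
  set S := (Finset.Ioc 0 X).filter (fun m => ∃ n ∈ I, n ∣ m) with hS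
  refine ⟨S, fun m hm => by simpa [hS] using hm, ?_⟩
  set r : ℕ → ℝ := fun m => ∑ n ∈ I, if n ∣ m then (1:ℝ) else 0 with hr
  have hN0 : (0:ℝ) < N := by exact_mod_cast hN
  have hL : 0 ≤ Real.log (2 * N) := Real.log_nonneg (by
    have : (1:ℝ) ≤ N := by exact_mod_cast hN
    linarith)
  rcases Nat.eq_zero_or_pos X with h0 | hXpos
  · rw [h0, Nat.cast_zero]; positivity
  have hXr : (0:ℝ) < X := by exact_mod_cast hXpos
  have hIdvd : ∀ n ∈ I, n ∣ (2 * N).factorial := by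
    intro n hn
    rw [hI, Finset.mem_Ioc] at hn
    exact Nat.dvd_factorial (by omega) hn.2
  have hcnt : ∀ n, n ∣ X → ∑ m ∈ Finset.Ioc 0 X, (if n ∣ m then (1:ℝ) else 0) = X / n := by
    intro n hn
    rw [Finset.sum_boole, Nat.Ioc_filter_dvd_card_eq_div, Nat.cast_div_charZero hn]
  have hsupp : ∀ m ∈ Finset.Ioc 0 X, m ∉ S → r m = 0 := by
    intro m hm hmS
    refine Finset.sum_eq_zero fun n hn => ?_
    rw [if_neg]
    intro hd
    exact hmS (Finset.mem_filter.2 ⟨hm, n, hn, hd⟩)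
  have hsub : S ⊆ Finset.Ioc 0 X := Finset.filter_subset _ _
  have h1 : ∑ m ∈ S, r m = ∑ n ∈ I, (X : ℝ) / n := by
    rw [Finset.sum_subset hsub hsupp, Finset.sum_comm]
    refine Finset.sum_congr rfl fun n hn => hcnt n ?_
    exact (hIdvd n hn).trans (hX ▸ (dvd_pow_self _ two_ne_zero).mul_left _)
  have h2 : ∑ m ∈ S, r m ^ 2 = ∑ n ∈ I, ∑ k ∈ I, (X : ℝ) / (Nat.lcm n k : ℕ) := by
    rw [Finset.sum_subset hsub (fun m hm hmS => by rw [hsupp m hm hmS]; norm_num)]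
    simp only [hr, sq, Finset.sum_mul_sum]
    rw [Finset.sum_comm]
    refine Finset.sum_congr rfl fun n hn => ?_
    rw [Finset.sum_comm]
    refine Finset.sum_congr rfl fun k hk => ?_
    rw [← hcnt (Nat.lcm n k)]
    · refine Finset.sum_congr rfl fun m _ => ?_
      by_cases ha : n ∣ m <;> by_cases hb : k ∣ m <;> simp [Nat.lcm_dvd_iff, ha, hb]
    · exact (Nat.lcm_dvd (hIdvd n hn) (hIdvd k hk)).trans (hX ▸ (dvd_pow_self _ two_ne_zero).mul_left _)
  have h3 : (X : ℝ) / 2 ≤ ∑ m ∈ S, r m := by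
    rw [h1]
    have : ∑ n ∈ I, (X : ℝ) / (2 * N) = X / 2 := by
      rw [Finset.sum_const, hI, Nat.card_Ioc, nsmul_eq_mul, show 2 * N - N = N by omega]
      field_simp
    rw [← this]
    refine Finset.sum_le_sum fun n hn => ?_
    rw [hI, Finset.mem_Ioc] at hn
    have : (0:ℝ) < n := by exact_mod_cast (by omega : 0 < n)
    have h' : (n:ℝ) ≤ 2 * N := by exact_mod_cast hn.2
    gcongr
  have h4 : ∑ m ∈ S, r m ^ 2 ≤ X * (9 * (1 + Real.log (2 * N))) := by
    rw [h2]
    calc ∑ n ∈ I, ∑ k ∈ I, (X : ℝ) / (Nat.lcm n k : ℕ)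
        ≤ ∑ n ∈ I, ∑ k ∈ I, (X / (N:ℝ)^2) * (Nat.gcd n k : ℕ) := by
          refine Finset.sum_le_sum fun n hn => Finset.sum_le_sum fun k hk => ?_
          rw [hI, Finset.mem_Ioc] at hn hk
          have hg : 0 < Nat.gcd n k := Nat.gcd_pos_of_pos_left _ (by omega)
          have hl : 0 < Nat.lcm n k := Nat.lcm_pos (by omega) (by omega)
          have hlr : (0:ℝ) < (Nat.lcm n k : ℕ) := by exact_mod_cast hl
          have hm : ((Nat.gcd n k : ℕ) : ℝ) * (Nat.lcm n k : ℕ) = n * k := by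
            exact_mod_cast Nat.gcd_mul_lcm n k
          have hn' : (N:ℝ) ≤ n := by exact_mod_cast hn.1.le
          have hk' : (N:ℝ) ≤ k := by exact_mod_cast hk.1.le
          rw [div_le_iff₀ hlr, mul_assoc, hm, div_mul_eq_mul_div, le_div_iff₀ (by positivity), sq]
          gcongr
      _ = (X / (N:ℝ)^2) * ∑ n ∈ I, ∑ k ∈ I, ((Nat.gcd n k : ℕ) : ℝ) := by
          simp only [Finset.mul_sum]
      _ ≤ (X / (N:ℝ)^2) * (9 * (N : ℝ) ^ 2 * (1 + Real.log (2 * N))) := by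
          gcongr
          exact gcd_sum N hN
      _ = _ := by field_simp
  have h5 : (∑ m ∈ S, r m) ^ 2 ≤ S.card * ∑ m ∈ S, r m ^ 2 := sq_sum_le_card_mul_sum_sq
  have h6 : ((X:ℝ) / 2) ^ 2 ≤ S.card * (X * (9 * (1 + Real.log (2 * N)))) := by
    calc ((X:ℝ) / 2) ^ 2 ≤ (∑ m ∈ S, r m) ^ 2 := by gcongr
      _ ≤ _ := h5
      _ ≤ _ := by gcongr
  have h7 : (X:ℝ) * X ≤ X * (36 * (1 + Real.log (2 * N)) * S.card) := by nlinarith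
  exact le_of_mul_le_mul_left h7 hXr

theorem diam_bound_aux (N : ℕ) (hN : 1 ≤ N) (f : ℝ → ℂ) (hf : Integrable f)
    (hf0 : (∫ x, f x) ≠ 0)
    (ht : ∀ j : ℕ, 1 ≤ j → j ≤ N → ∃ lev : ℂ, TilesAt1 f ((N : ℝ) / (N + j)) lev)
    (a D : ℝ) (hD : 0 ≤ D) (hs : ∀ᵐ x, f x ≠ 0 → |x - a| ≤ D) :
    (N : ℝ) ≤ 8 * Real.pi * D * (36 * (1 + Real.log (2 * N))) := by
  classical
  obtain ⟨hdiff, hbd⟩ := transform_diff f hf a D hD hs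
  set F : ℂ → ℂ := fun z => ∫ x, f x * Complex.exp (-2 * Real.pi * Complex.I * z * (x - a)) with hF
  set A := ∫ x, ‖f x‖ with hA
  have hN0 : (0:ℝ) < N := by exact_mod_cast hN
  have hF0 : F 0 = ∫ x, f x := by simp [hF]
  have hF0n : 0 < ‖F 0‖ := by rw [hF0]; exact norm_pos_iff.2 hf0
  have hA0 : 0 < A := by
    have := hbd 0
    simp only [norm_zero, mul_zero, Real.exp_zero, mul_one] at this
    refine lt_of_lt_of_le hF0n ?_
    simpa [hF] using this
  have hL : 0 ≤ Real.log (2 * N) := Real.log_nonneg (by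
    have : (1:ℝ) ≤ N := by exact_mod_cast hN
    linarith)
  set K := 36 * (1 + Real.log (2 * N)) with hK
  have hK0 : 0 < K := by positivity
  have hzero : ∀ m : ℕ, 0 < m → (∃ n ∈ Finset.Ioc N (2 * N), n ∣ m) → F ((m / N : ℝ) : ℂ) = 0 := by
    rintro m hm ⟨n, hn, k, rfl⟩
    rw [Finset.mem_Ioc] at hn
    obtain ⟨lev, hlev⟩ := ht (n - N) (by omega) (by omega)
    have hn0 : (0:ℝ) < n := by exact_mod_cast (by omega : 0 < n)
    have hc : (N : ℝ) + ((n - N : ℕ) : ℝ) = n := by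
      rw [Nat.cast_sub hn.1.le]; ring
    rw [hc] at hlev
    have hk : k ≠ 0 := by rintro rfl; simp at hm
    have h := transform_zero f hf _ (by positivity) lev hlev k hk (((n * k : ℕ) : ℝ) / N)
      (by push_cast; field_simp)
    simp only [hF]
    have : ∀ x : ℝ, f x * Complex.exp (-2 * Real.pi * Complex.I * ((((n * k : ℕ) : ℝ) / N : ℝ) : ℂ) * (x - a))
        = (f x * Complex.exp (-2 * Real.pi * Complex.I * ((((n * k : ℕ) : ℝ) / N : ℝ) : ℂ) * x)) *
          Complex.exp (2 * Real.pi * Complex.I * ((((n * k : ℕ) : ℝ) / N : ℝ) : ℂ) * a) := by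
      intro x
      rw [mul_assoc (f x), ← Complex.exp_add]
      congr 2
      ring
    simp only [this]
    rw [integral_mul_const, h, zero_mul]
  have hmain : ∀ M : ℕ, 1 ≤ M → ((M * (2 * N).factorial ^ 2 : ℕ) : ℝ) / K ≤
      Real.log (A / ‖F 0‖) + 8 * Real.pi * D * ((M * (2 * N).factorial ^ 2 : ℕ) : ℝ) / N := by
    intro M hM
    obtain ⟨S, hS, hcount⟩ := count_bound N hN M
    have hXpos : 0 < M * (2 * N).factorial ^ 2 := by positivity
    set X := M * (2 * N).factorial ^ 2 with hX
    have hXr : (0:ℝ) < X := by exact_mod_cast hXpos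
    have hinj : Function.Injective (fun m : ℕ => ((m / N : ℝ) : ℂ)) := by
      intro x y hxy
      have h1 : (x / N : ℝ) = y / N := Complex.ofReal_injective hxy
      rw [div_left_inj' hN0.ne'] at h1
      exact_mod_cast h1
    have hR : 0 < 4 * X / (N:ℝ) := by positivity
    have hz := zero_bound (4 * X / N) hR (S.image (fun m : ℕ => ((m / N : ℝ) : ℂ))) F
      (A * Real.exp (2 * Real.pi * D * (4 * X / N))) hdiff ?_ ?_
    · rw [Finset.card_image_of_injective _ hinj] at hz
      have h1 : (3:ℝ) ^ S.card ≤ (A / ‖F 0‖) * Real.exp (2 * Real.pi * D * (4 * X / N)) := by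
        rw [div_mul_eq_mul_div, le_div_iff₀ hF0n]
        linarith
      have h2 := Real.log_le_log (by positivity) h1
      rw [Real.log_pow, Real.log_mul (by positivity) (by positivity), Real.log_exp] at h2
      have h3 : (1:ℝ) ≤ Real.log 3 := by
        rw [Real.le_log_iff_exp_le (by norm_num)]
        have := Real.exp_one_lt_d9
        linarith
      have h4 : (X:ℝ) / K ≤ S.card := by
        rw [div_le_iff₀ hK0]
        linarith
      have h5 : (S.card : ℝ) ≤ S.card * Real.log 3 := le_mul_of_one_le_right (by positivity) h3
      have h6 : 8 * Real.pi * D * (X : ℝ) / N = 2 * Real.pi * D * (4 * X / N) := by ring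
      rw [h6]
      linarith
    · intro z hz
      have hz' : ‖z‖ = 4 * X / N := by simpa using hz
      rw [← hz']
      exact hbd z
    · intro z hz
      obtain ⟨m, hm, rfl⟩ := Finset.mem_image.1 hz
      replace hm := hS m hm
      refine ⟨?_, hzero m hm.1.1 hm.2⟩
      rw [Complex.norm_real, Real.norm_eq_abs, abs_of_nonneg (by positivity)]
      have : (m:ℝ) ≤ X := by exact_mod_cast hm.1.2
      rw [show 4 * (X:ℝ) / N / 4 = X / N by ring]
      gcongr
  by_contra hcon
  push Not at hcon
  have hδ : 0 < 1 / K - 8 * Real.pi * D / N := by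
    rw [sub_pos, div_lt_div_iff₀ hN0 hK0]
    linarith
  set δ := 1 / K - 8 * Real.pi * D / N with hδd
  obtain ⟨M, hM⟩ := exists_nat_gt (Real.log (A / ‖F 0‖) / δ)
  have h1 := hmain (M + 1) (by omega)
  rw [div_lt_iff₀ hδ] at hM
  have hfac : (1:ℝ) ≤ (((2 * N).factorial ^ 2 : ℕ) : ℝ) := by
    exact_mod_cast Nat.one_le_iff_ne_zero.2 (by positivity)
  have h2 : (M : ℝ) ≤ (((M + 1) * (2 * N).factorial ^ 2 : ℕ) : ℝ) := by
    rw [Nat.cast_mul]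
    push_cast at hfac ⊢
    have : (0:ℝ) ≤ M := by positivity
    nlinarith
  have h3 : (((M + 1) * (2 * N).factorial ^ 2 : ℕ) : ℝ) * δ ≤ Real.log (A / ‖F 0‖) := by
    rw [hδd, mul_sub]
    have e1 : (((M + 1) * (2 * N).factorial ^ 2 : ℕ) : ℝ) * (1 / K) = (((M + 1) * (2 * N).factorial ^ 2 : ℕ) : ℝ) / K := by ring
    have e2 : (((M + 1) * (2 * N).factorial ^ 2 : ℕ) : ℝ) * (8 * Real.pi * D / N) =
      8 * Real.pi * D * (((M + 1) * (2 * N).factorial ^ 2 : ℕ) : ℝ) / N := by ring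
    rw [e1, e2]
    linarith
  have h4 := mul_le_mul_of_nonneg_right h2 hδ.le
  linarith

/-- For every `ε > 0` there is `c_ε > 0` such that for all `N ≥ 1`: any
`f ∈ L¹(ℝ)` with `∫ f ≠ 0` tiling with each lattice `(N/(N+j))·ℤ`, `j = 1, …, N`,
satisfies `diam (supp f) ≥ c_ε · N^{1−ε}`. -/
theorem diam_lower_bound_one_dim (ε : ℝ) (hε : 0 < ε) :
    ∃ c : ℝ, 0 < c ∧
      ∀ N : ℕ, 1 ≤ N → ∀ f : ℝ → ℂ,
        Integrable f → (∫ x, f x) ≠ 0 →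
        (∀ j : ℕ, 1 ≤ j → j ≤ N → ∃ lev : ℂ, TilesAt1 f ((N : ℝ) / (N + j)) lev) →
        ENNReal.ofReal (c * (N : ℝ) ^ ((1 : ℝ) - ε)) ≤ EMetric.diam (essSupp f) := by
  have hB : 0 < 288 * Real.pi * (1 + (2:ℝ) ^ ε / ε) := by
    have := Real.pi_pos
    positivity
  refine ⟨(288 * Real.pi * (1 + (2:ℝ) ^ ε / ε))⁻¹, inv_pos.2 hB, ?_⟩
  intro N hN f hf hf0 ht
  by_cases htop : EMetric.diam (essSupp f) = ⊤
  · rw [htop]; exact le_top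
  have hae := ae_essSupp f
  have hne : (essSupp f).Nonempty := by
    by_contra h
    rw [Set.not_nonempty_iff_eq_empty] at h
    apply hf0
    rw [h] at hae
    exact integral_eq_zero_of_ae (hae.mono fun x hx => hx (Set.notMem_empty x))
  obtain ⟨a, ha⟩ := hne
  set D := (EMetric.diam (essSupp f)).toReal with hD
  have hs : ∀ᵐ x, f x ≠ 0 → |x - a| ≤ D := by
    filter_upwards [hae] with x hx hfx
    have hxs : x ∈ essSupp f := by
      by_contra h
      exact hfx (hx h)
    have h1 := EMetric.edist_le_diam_of_mem hxs ha
    rw [← Real.dist_eq, dist_edist]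
    exact ENNReal.toReal_mono htop h1
  have hmain := diam_bound_aux N hN f hf hf0 ht a D ENNReal.toReal_nonneg hs
  have hD0 : 0 ≤ D := ENNReal.toReal_nonneg
  have hN0 : (0:ℝ) < N := by exact_mod_cast hN
  have hN1 : (1:ℝ) ≤ N := by exact_mod_cast hN
  rw [ENNReal.ofReal_le_iff_le_toReal htop, ← hD]
  have hlog : 1 + Real.log (2 * N) ≤ (1 + (2:ℝ) ^ ε / ε) * (N:ℝ) ^ ε := by
    have h1 := Real.log_le_rpow_div (x := 2 * N) (by positivity) hε
    rw [Real.mul_rpow (by norm_num) hN0.le] at h1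
    have h2 : 1 ≤ (N:ℝ) ^ ε := Real.one_le_rpow hN1 hε.le
    have h3 : (1 + (2:ℝ) ^ ε / ε) * (N:ℝ) ^ ε = (N:ℝ) ^ ε + 2 ^ ε * (N:ℝ) ^ ε / ε := by ring
    rw [h3]
    linarith
  have hp : 0 < (N:ℝ) ^ ε := by positivity
  rw [Real.rpow_sub hN0, Real.rpow_one, inv_mul_le_iff₀ hB, div_le_iff₀ hp]
  calc (N:ℝ) ≤ 8 * Real.pi * D * (36 * (1 + Real.log (2 * N))) := hmain
    _ ≤ 8 * Real.pi * D * (36 * ((1 + (2:ℝ) ^ ε / ε) * (N:ℝ) ^ ε)) := by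
      have := Real.pi_pos
      gcongr
    _ = _ := by ring

end
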